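/- arXiv:2401.04509 — 2 statements merged into one kernel-verified Lean document; each statement's English description precedes it below -/
import Mathlib

section
/- Let T be a string of length n in which at least two distinct characters occur, let σ_T be the number of distinct characters occurring in T, and let k be the number of nonempty suffixes s of T such that s·a ∈ Substr(T) for some character a (i.e. the suffixes of T that also occur in T followed by a character). Then |RightM(T)| ≤ 2n − k − σ_T + 1. -/
def Substr {α : Type*} (T w : List α) : Prop := ∃ x z : List α, T = x ++ w ++ z

def RightM {α : Type*} (T : List α) : Set (List α) :=
  {w | Substr T w ∧ ((∃ a b : α, a ≠ b ∧ Substr T (w ++ [a]) ∧ Substr T (w ++ [b])) ∨ w <:+ T)}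

theorem substr_iff_isInfix {α : Type*} {T w : List α} : Substr T w ↔ w <:+: T :=
  ⟨fun ⟨x, z, h⟩ => ⟨x, z, h.symm⟩, fun ⟨x, z, h⟩ => ⟨x, z, h.symm⟩⟩

/-- `w` occurs in `T` followed by `x`, where `none` stands for the end of `T`. -/
def OccursBefore {α : Type*} (T w : List α) : Option α → Prop
  | some a => w ++ [a] <:+: T
  | none => w <:+ T

/-- `T` starts with `w` followed by `x`, where `none` stands for the end of `T`. -/
def StartsBefore {α : Type*} (T w : List α) : Option α → Prop
  | some a => w ++ [a] <+: T
  | none => w = T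

/-- The nonempty strings having two distinct right extensions in `T` followed by an end marker. -/
def branching {α : Type*} (T : List α) : Set (List α) :=
  {w | w ≠ [] ∧ ∃ x y : Option α, x ≠ y ∧ OccursBefore T w x ∧ OccursBefore T w y}

section

variable {α : Type*} {a : α} {T w v : List α} {x y : Option α}

theorem OccursBefore.isInfix (h : OccursBefore T w x) : w <:+: T := by
  cases x with
  | none => exact h.isInfix
  | some a => exact (List.prefix_append w [a]).isInfix.trans h

theorem StartsBefore.isPrefix (h : StartsBefore T w x) : w <+: T := by
  cases x with
  | none => exact h ▸ List.prefix_rfl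
  | some a => exact (List.prefix_append w [a]).trans h

theorem occursBefore_cons :
    OccursBefore (a :: T) w x ↔ StartsBefore (a :: T) w x ∨ OccursBefore T w x := by
  cases x with
  | none => exact List.suffix_cons_iff
  | some b => exact List.infix_cons_iff

theorem StartsBefore.unique (hx : StartsBefore T w x) (hy : StartsBefore T w y) : x = y := by
  cases x <;> cases y <;> simp only [StartsBefore] at hx hy
  · rfl
  · subst hx; have := hy.length_le; simp at this
  · subst hy; have := hx.length_le; simp at this
  · have := (List.prefix_of_prefix_length_le hx hy (by simp)).eq_of_length (by simp)
    simpa using this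

/-- A longer prefix of the string already contains the letter following `w`. -/
theorem StartsBefore.occursBefore_of_length_lt (hx : StartsBefore T w x) (hv : v <+: T)
    (hlt : w.length < v.length) {U : List α} (hU : v <:+: U) : OccursBefore U w x := by
  cases x with
  | none =>
    simp only [StartsBefore] at hx
    subst hx
    exact absurd hv.length_le (by omega)
  | some b =>
    exact (List.prefix_of_prefix_length_le hx hv (by simpa using hlt)).isInfix.trans hU

theorem exists_startsBefore_of_mem_branching_diff
    (hw : w ∈ branching (a :: T) \ branching T) :
    w ≠ [] ∧ w <:+: T ∧ ∃ x, StartsBefore (a :: T) w x ∧ ¬ OccursBefore T w x := by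
  obtain ⟨⟨hne, x, y, hxy, hx, hy⟩, hnot⟩ := hw
  have hnot' : ¬ (OccursBefore T w x ∧ OccursBefore T w y) :=
    fun h => hnot ⟨hne, x, y, hxy, h⟩
  refine ⟨hne, ?_⟩
  rcases occursBefore_cons.1 hx with hx | hx <;> rcases occursBefore_cons.1 hy with hy | hy
  · exact absurd (hx.unique hy) hxy
  · exact ⟨hy.isInfix, x, hx, fun h => hnot' ⟨h, hy⟩⟩
  · exact ⟨hx.isInfix, y, hy, fun h => hnot' ⟨hx, h⟩⟩
  · exact absurd ⟨hx, hy⟩ hnot'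

theorem branching_diff_subsingleton :
    (branching (a :: T) \ branching T).Subsingleton := by
  intro w hw v hv
  obtain ⟨-, hwT, x, hx, hx'⟩ := exists_startsBefore_of_mem_branching_diff hw
  obtain ⟨-, hvT, y, hy, hy'⟩ := exists_startsBefore_of_mem_branching_diff hv
  rcases lt_trichotomy w.length v.length with h | h | h
  · exact absurd (hx.occursBefore_of_length_lt hy.isPrefix h hvT) hx'
  · exact (List.prefix_of_prefix_length_le hx.isPrefix hy.isPrefix h.le).eq_of_length h
  · exact absurd (hy.occursBefore_of_length_lt hx.isPrefix h hwT) hy'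

theorem mem_of_mem_branching_diff (hw : w ∈ branching (a :: T) \ branching T) : a ∈ T := by
  obtain ⟨hne, hwT, x, hx, -⟩ := exists_startsBefore_of_mem_branching_diff hw
  cases w with
  | nil => exact absurd rfl hne
  | cons b w =>
    obtain ⟨rfl, -⟩ := List.cons_prefix_cons.1 hx.isPrefix
    exact hwT.subset List.mem_cons_self

theorem finite_setOf_isInfix (T : List α) : {w | w <:+: T}.Finite :=
  (List.finite_toSet T.sublists).subset fun _ hw => List.mem_sublists.2 hw.sublist

theorem finite_branching (T : List α) : (branching T).Finite :=
  (finite_setOf_isInfix T).subset fun _ ⟨_, _, _, _, hx, _⟩ => hx.isInfix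

theorem ncard_branching_add_card_le [DecidableEq α] (T : List α) :
    (branching T).ncard + T.toFinset.card ≤ T.length := by
  induction T with
  | nil =>
    have : branching ([] : List α) = ∅ := by
      refine Set.eq_empty_of_forall_notMem fun w ⟨hne, _, _, _, hx, _⟩ => hne ?_
      exact List.infix_nil.1 hx.isInfix
    simp [this]
  | cons a T ih =>
    have hle := Set.ncard_le_ncard_sdiff_add_ncard (branching (a :: T)) (branching T)
      (finite_branching T)
    by_cases ha : a ∈ T
    · have h1 : (branching (a :: T) \ branching T).ncard ≤ 1 :=
        have := ((finite_branching (a :: T)).subset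
          (Set.sdiff_subset (t := branching T))).to_subtype
        Set.ncard_le_one_iff_subsingleton.2 branching_diff_subsingleton
      rw [List.toFinset_cons, Finset.insert_eq_of_mem (List.mem_toFinset.2 ha), List.length_cons]
      omega
    · have h0 : branching (a :: T) \ branching T = ∅ :=
        Set.eq_empty_of_forall_notMem fun w hw => ha (mem_of_mem_branching_diff hw)
      rw [h0, Set.ncard_empty] at hle
      rw [List.toFinset_cons, Finset.card_insert_of_notMem (by simpa using ha), List.length_cons]
      omega

theorem finite_setOf_isSuffix (T : List α) : {w | w <:+ T}.Finite :=
  (finite_setOf_isInfix T).subset fun _ hw => hw.isInfix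

theorem ncard_setOf_isSuffix_le (T : List α) : {w | w <:+ T}.ncard ≤ T.length + 1 := by
  classical
  have h : {w | w <:+ T} = (T.tails.toFinset : Set (List α)) := by ext; simp
  rw [h, Set.ncard_coe_finset]
  simpa using T.tails.toFinset_card_le

end

theorem weiner_tree_size_bound {α : Type*} [DecidableEq α] (T : List α) (n : ℕ)
    (hn : T.length = n)
    (htwo : ∃ a b : α, a ∈ T ∧ b ∈ T ∧ a ≠ b) :
    (RightM T).ncard
      + {s : List α | s ≠ [] ∧ s <:+ T ∧ ∃ a : α, Substr T (s ++ [a])}.ncard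
      + T.toFinset.card ≤ 2 * n + 1 := by
  set K := {s : List α | s ≠ [] ∧ s <:+ T ∧ ∃ a : α, Substr T (s ++ [a])}
  have hKS : K ⊆ {w | w <:+ T} := fun s hs => hs.2.1
  have hKB : K ⊆ branching T := fun s ⟨hne, hs, a, ha⟩ =>
    ⟨hne, none, some a, by simp, hs, substr_iff_isInfix.1 ha⟩
  have hsub : RightM T ⊆ branching T ∪ ({w | w <:+ T} \ K) := by
    rintro w ⟨-, h⟩
    by_cases hs : w <:+ T
    · by_cases hK : w ∈ K
      · exact Or.inl (hKB hK)
      · exact Or.inr ⟨hs, hK⟩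
    · obtain ⟨a, b, hab, ha, hb⟩ := h.resolve_right hs
      exact Or.inl ⟨fun h => hs (h ▸ List.nil_suffix), some a, some b, by simpa using hab,
        substr_iff_isInfix.1 ha, substr_iff_isInfix.1 hb⟩
  have hR := (Set.ncard_le_ncard hsub ((finite_branching T).union
    (finite_setOf_isSuffix T).sdiff)).trans (Set.ncard_union_le _ _)
  have hK := Set.ncard_sdiff_add_ncard_of_subset hKS (finite_setOf_isSuffix T)
  have hS := ncard_setOf_isSuffix_le T
  have hB := ncard_branching_add_card_le T
  omega
end

section
/- Fix k ≥ 1 and let S_k = [k+1] ++ (concatenation over i = 1, …, k of [1, 2, …, i] ++ [k+1+i]) be the string over ℕ with digits 1, …, k and barred characters b̄_j = k + j. Then the length of S_k is (k+1)(k+2)/2 and e_L(S_k) ≥ (2k + 1) + k(k−1)/2 = (k+1)(k+2)/2; in particular e_L(S_k) ≥ |S_k|. -/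
def LeftM {α : Type*} (T : List α) : Set (List α) :=
  {w | Substr T w ∧ ((∃ a b : α, a ≠ b ∧ Substr T (a :: w) ∧ Substr T (b :: w)) ∨ w <+: T)}

def MaxSub {α : Type*} (T : List α) : Set (List α) := LeftM T ∩ RightM T

noncomputable def eL {α : Type*} (T : List α) : ℕ :=
  {p : α × List α | p.2 ∈ MaxSub T ∧ Substr T (p.1 :: p.2)}.ncard

def Sk (k : ℕ) : List ℕ :=
  (k + 1) :: ((List.range k).map (fun i => ((List.range (i + 1)).map (· + 1)) ++ [k + 2 + i])).flatten

theorem finite_leftExtensions {α : Type*} (T : List α) :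
    {p : α × List α | p.2 ∈ MaxSub T ∧ Substr T (p.1 :: p.2)}.Finite := by
  have hfin : {l : List α | l.Sublist T}.Finite :=
    (List.finite_toSet T.sublists).subset fun l hl => List.mem_sublists.2 hl
  refine Set.Finite.of_finite_image (f := fun p : α × List α => p.1 :: p.2)
    (hfin.subset ?_) ?_
  · rintro _ ⟨p, hp, rfl⟩
    exact (substr_iff_isInfix.1 hp.2).sublist
  · rintro ⟨a, u⟩ - ⟨b, v⟩ - h
    simpa using h

theorem nil_mem_MaxSub {α : Type*} (T : List α) : [] ∈ MaxSub T :=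
  ⟨⟨⟨[], T, rfl⟩, Or.inr T.nil_prefix⟩, ⟨⟨[], T, rfl⟩, Or.inr T.nil_suffix⟩⟩

/-- The run `1, 2, …, n`. -/
def digitRun (n : ℕ) : List ℕ := (List.range n).map (· + 1)

/-- The prefix of `Sk k` made of its first character and its first `n` blocks. -/
def SkPrefix (k n : ℕ) : List ℕ :=
  (k + 1) :: ((List.range n).map (fun i => digitRun (i + 1) ++ [k + 2 + i])).flatten

theorem digitRun_succ (n : ℕ) : digitRun (n + 1) = digitRun n ++ [n + 1] := by
  simp [digitRun, List.range_succ]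

theorem length_digitRun (n : ℕ) : (digitRun n).length = n := by simp [digitRun]

theorem digitRun_prefix {m n : ℕ} (h : m ≤ n) : digitRun m <+: digitRun n := by
  induction n, h using Nat.le_induction with
  | base => exact List.prefix_rfl
  | succ n _ ih => exact ih.trans (digitRun_succ n ▸ List.prefix_append _ _)

theorem SkPrefix_succ (k n : ℕ) :
    SkPrefix k (n + 1) = SkPrefix k n ++ (digitRun (n + 1) ++ [k + 2 + n]) := by
  simp [SkPrefix, List.range_succ]

theorem SkPrefix_prefix (k : ℕ) {m n : ℕ} (h : m ≤ n) : SkPrefix k m <+: SkPrefix k n := by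
  induction n, h using Nat.le_induction with
  | base => exact List.prefix_rfl
  | succ n _ ih => exact ih.trans (SkPrefix_succ k n ▸ List.prefix_append _ _)

theorem exists_SkPrefix_eq_append (k n : ℕ) : ∃ l, SkPrefix k n = l ++ [k + 1 + n] := by
  cases n with
  | zero => exact ⟨[], by simp [SkPrefix]⟩
  | succ n =>
    exact ⟨SkPrefix k n ++ digitRun (n + 1), by
      rw [SkPrefix_succ, List.append_assoc, show k + 2 + n = k + 1 + (n + 1) by omega]⟩

theorem length_SkPrefix (k n : ℕ) : (SkPrefix k n).length = (n + 1) * (n + 2) / 2 := by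
  have h : 2 * (SkPrefix k n).length = (n + 1) * (n + 2) := by
    induction n with
    | zero => simp [SkPrefix]
    | succ n ih =>
      simp only [SkPrefix_succ, List.length_append, length_digitRun, List.length_singleton]
      linarith
  omega

theorem block_isInfix_Sk {k i : ℕ} (hi : i < k) :
    (k + 1 + i) :: (digitRun (i + 1) ++ [k + 2 + i]) <:+: Sk k := by
  obtain ⟨l, hl⟩ := exists_SkPrefix_eq_append k i
  refine List.IsInfix.trans ?_ (SkPrefix_prefix k hi).isInfix
  exact ⟨l, [], by simp [SkPrefix_succ, hl]⟩

theorem cons_digitRun_isInfix_Sk {k i m : ℕ} (hi : i < k) (hm : m ≤ i + 1) :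
    (k + 1 + i) :: digitRun m <:+: Sk k := by
  refine List.IsInfix.trans (List.IsPrefix.isInfix ?_) (block_isInfix_Sk hi)
  exact List.cons_prefix_cons.2 ⟨rfl, (digitRun_prefix hm).trans (List.prefix_append _ _)⟩

theorem digitRun_isInfix_Sk {k m : ℕ} (hm : m ≤ k) : digitRun m <:+: Sk k := by
  cases m with
  | zero => exact List.nil_infix
  | succ m =>
    exact (List.suffix_cons (k + 1 + m) _).isInfix.trans (cons_digitRun_isInfix_Sk hm le_rfl)

theorem singleton_isInfix_Sk {k c : ℕ} (hk : 1 ≤ k) (hc : c < 2 * k + 1) :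
    [c + 1] <:+: Sk k := by
  rcases lt_trichotomy c k with h | h | h
  · refine List.IsInfix.trans ?_ (digitRun_isInfix_Sk (m := c + 1) h)
    exact ⟨digitRun c, [], by simp [digitRun_succ]⟩
  · subst h
    exact cons_digitRun_isInfix_Sk (i := 0) (m := 0) hk (Nat.zero_le _)
  · obtain ⟨i, rfl⟩ : ∃ i, c = k + 1 + i := ⟨c - (k + 1), by omega⟩
    refine List.IsInfix.trans ?_ (block_isInfix_Sk (show i < k by omega))
    exact ⟨(k + 1 + i) :: digitRun (i + 1), [], by simp; omega⟩

theorem digitRun_mem_MaxSub {k j : ℕ} (hj : j + 1 < k) : digitRun (j + 1) ∈ MaxSub (Sk k) := by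
  have hsub : Substr (Sk k) (digitRun (j + 1)) :=
    substr_iff_isInfix.2 (digitRun_isInfix_Sk hj.le)
  refine ⟨⟨hsub, Or.inl ⟨k + 1 + j, k + 1 + (j + 1), by omega, ?_, ?_⟩⟩,
    ⟨hsub, Or.inl ⟨k + 2 + j, j + 1 + 1, by omega, ?_, ?_⟩⟩⟩ <;> rw [substr_iff_isInfix]
  · exact cons_digitRun_isInfix_Sk (by omega) le_rfl
  · exact cons_digitRun_isInfix_Sk hj (by omega)
  · exact (List.suffix_cons _ _).isInfix.trans (block_isInfix_Sk (show j < k by omega))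
  · rw [← digitRun_succ]
    exact digitRun_isInfix_Sk hj

theorem le_eL_Sk {k : ℕ} (hk : 1 ≤ k) : (2 * k + 1) + k * (k - 1) / 2 ≤ eL (Sk k) := by
  let A : Finset (ℕ × List ℕ) := (Finset.range (2 * k + 1)).image fun c => (c + 1, [])
  let B : Finset (ℕ × List ℕ) := ((Finset.range k).sigma fun i => Finset.range i).image
    fun p => (k + 1 + p.1, digitRun (p.2 + 1))
  have hA : A.card = 2 * k + 1 := by
    rw [Finset.card_image_of_injective _ (fun a b h => by simpa using h), Finset.card_range]
  have hB : B.card = k * (k - 1) / 2 := by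
    rw [Finset.card_image_of_injective, Finset.card_sigma]
    · simp [Finset.sum_range_id]
    · rintro ⟨a, b⟩ ⟨c, d⟩ h
      obtain ⟨h₁, h₂⟩ := Prod.mk.inj h
      have h₃ := congrArg List.length h₂
      simp only [length_digitRun] at h₁ h₃
      obtain rfl : a = c := by omega
      obtain rfl : b = d := by omega
      rfl
  have hAB : Disjoint A B := by
    rw [Finset.disjoint_left]
    simp only [A, B, Finset.mem_image]
    rintro _ ⟨c, -, rfl⟩ ⟨p, -, h⟩
    simpa [length_digitRun] using congrArg (fun q => q.2.length) h
  rw [← hA, ← hB, ← Finset.card_union_of_disjoint hAB, ← Set.ncard_coe_finset]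
  refine Set.ncard_le_ncard ?_ (finite_leftExtensions _)
  intro p hp
  simp only [A, B, Finset.coe_union, Set.mem_union, Finset.mem_coe, Finset.mem_image,
    Finset.mem_range, Finset.mem_sigma] at hp
  rcases hp with ⟨c, hc, rfl⟩ | ⟨⟨i, j⟩, ⟨hi, hj⟩, rfl⟩
  · exact ⟨nil_mem_MaxSub _, substr_iff_isInfix.2 (singleton_isInfix_Sk hk hc)⟩
  · dsimp only at hi hj
    have hjk : j + 1 < k := by omega
    have hji : j + 1 ≤ i + 1 := by omega
    exact ⟨digitRun_mem_MaxSub hjk, substr_iff_isInfix.2 (cons_digitRun_isInfix_Sk hi hji)⟩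

theorem eL_Sk_lower_bound (k : ℕ) (hk : 1 ≤ k) :
    (Sk k).length = (k + 1) * (k + 2) / 2 ∧
    (2 * k + 1) + k * (k - 1) / 2 ≤ eL (Sk k) ∧
    (2 * k + 1) + k * (k - 1) / 2 = (k + 1) * (k + 2) / 2 ∧
    (Sk k).length ≤ eL (Sk k) := by
  have hlen : (Sk k).length = (k + 1) * (k + 2) / 2 := length_SkPrefix k k
  have harith : (2 * k + 1) + k * (k - 1) / 2 = (k + 1) * (k + 2) / 2 := by
    obtain ⟨n, rfl⟩ : ∃ n, k = n + 1 := ⟨k - 1, by omega⟩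
    have h : (n + 1 + 1) * (n + 1 + 2) = (n + 1) * n + 2 * (2 * (n + 1) + 1) := by ring
    rw [h, Nat.add_sub_cancel]
    omega
  exact ⟨hlen, le_eL_Sk hk, harith, by rw [hlen, ← harith]; exact le_eL_Sk hk⟩
end
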